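/- arXiv:1801.05977 — 5 statements merged into one kernel-verified Lean document; each statement's English description precedes it below -/
import Mathlib

section
/- For every x = (x₁,x₂) ∈ ℝ² with x₂ ≠ 0, the series Σ_{n∈ℤ} (1/βₙ) exp(i αₙ x₁ + i βₙ |x₂|) converges absolutely; in particular the α-quasi-periodic Green's function G(x) = (i/(4π)) Σ_{n∈ℤ} (1/βₙ) exp(i αₙ x₁ + i βₙ |x₂|) is well defined at every point with x₂ ≠ 0. -/
open MeasureTheory Complex Real

noncomputable section

/-- βₙ = √(k² − αₙ²) if |αₙ| ≤ k, and i√(αₙ² − k²) otherwise, where αₙ = α + n. -/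
def betaCoef (k α : ℝ) (n : ℤ) : ℂ :=
  if |α + (n : ℝ)| ≤ k then ((Real.sqrt (k ^ 2 - (α + (n : ℝ)) ^ 2) : ℝ) : ℂ)
  else Complex.I * ((Real.sqrt ((α + (n : ℝ)) ^ 2 - k ^ 2) : ℝ) : ℂ)

/-- The general term of the eigenfunction expansion of the quasi-periodic Green's function. -/
def greenTerm (k α : ℝ) (x : EuclideanSpace ℝ (Fin 2)) (n : ℤ) : ℂ :=
  (1 / betaCoef k α n) *
    Complex.exp (Complex.I * ((α + (n : ℝ) : ℝ) : ℂ) * (x 0 : ℂ) +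
      Complex.I * betaCoef k α n * ((|x 1| : ℝ) : ℂ))

/-- The α-quasi-periodic Green's function G(x) = (i/(4π)) Σₙ (1/βₙ) e^{iαₙx₁+iβₙ|x₂|}. -/
def greenG (k α : ℝ) (x : EuclideanSpace ℝ (Fin 2)) : ℂ :=
  (Complex.I / (4 * (π : ℂ))) * ∑' n : ℤ, greenTerm k α x n

theorem summable_exp_neg_mul_abs_int {c : ℝ} (hc : 0 < c) :
    Summable fun n : ℤ => Real.exp (-(c * |(n : ℝ)|)) := by
  have h : Summable fun n : ℕ => Real.exp ((n : ℝ) * -c) :=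
    Real.summable_exp_nat_mul_iff.mpr (by linarith)
  have h' : Summable fun n : ℕ => Real.exp (-(c * |(n : ℝ)|)) := by
    refine h.congr fun n => ?_
    rw [abs_of_nonneg (Nat.cast_nonneg n)]
    ring_nf
  exact Summable.of_nat_of_neg (by simpa using h') (by simpa using h')

theorem half_abs_le_sqrt {k α t : ℝ} (ht : 4 * (|α| + |k|) ≤ |t|) :
    |t| / 2 ≤ Real.sqrt ((α + t) ^ 2 - k ^ 2) := by
  apply Real.le_sqrt_of_sq_le
  have h : |t| ≤ |α + t| + |α| := by
    have := abs_sub (α + t) α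
    rwa [add_sub_cancel_left] at this
  have hα := abs_nonneg α
  have hk := abs_nonneg k
  rw [← sq_abs (α + t), ← sq_abs k]
  nlinarith [abs_nonneg t]

theorem norm_greenTerm_of_lt {k α : ℝ} {x : EuclideanSpace ℝ (Fin 2)} {n : ℤ}
    (hn : k < |α + (n : ℝ)|) :
    ‖greenTerm k α x n‖ = (Real.sqrt ((α + (n : ℝ)) ^ 2 - k ^ 2))⁻¹ *
      Real.exp (-(Real.sqrt ((α + (n : ℝ)) ^ 2 - k ^ 2) * |x 1|)) := by
  rw [greenTerm, betaCoef, if_neg hn.not_ge, norm_mul, Complex.norm_exp]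
  simp [abs_of_nonneg (Real.sqrt_nonneg _)]

theorem norm_greenTerm_le {k α : ℝ} {x : EuclideanSpace ℝ (Fin 2)} {n : ℤ}
    (hn : 4 * (|α| + |k|) + 2 ≤ |(n : ℝ)|) :
    ‖greenTerm k α x n‖ ≤ Real.exp (-(|x 1| / 2 * |(n : ℝ)|)) := by
  have hα := abs_nonneg α
  have hk := abs_nonneg k
  have hs : |(n : ℝ)| / 2 ≤ Real.sqrt ((α + (n : ℝ)) ^ 2 - k ^ 2) :=
    half_abs_le_sqrt (by linarith)
  have hlt : k < |α + (n : ℝ)| := by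
    have h := abs_sub (α + (n : ℝ)) α
    rw [add_sub_cancel_left] at h
    linarith [le_abs_self k]
  rw [norm_greenTerm_of_lt hlt]
  calc _ ≤ 1 * Real.exp (-(|x 1| / 2 * |(n : ℝ)|)) := by
        gcongr ?_ * Real.exp (-?_)
        · exact inv_le_one_of_one_le₀ (by linarith)
        · nlinarith [abs_nonneg (x 1)]
    _ = _ := one_mul _

/-- For every x with x₂ ≠ 0, the series defining the quasi-periodic Green's function
converges absolutely; in particular G is well defined there. -/
theorem statement0 (k α : ℝ) (hk : 0 < k) (hβ : ∀ n : ℤ, betaCoef k α n ≠ 0)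
    (x : EuclideanSpace ℝ (Fin 2)) (hx : x 1 ≠ 0) :
    Summable (fun n : ℤ => ‖greenTerm k α x n‖) ∧
      Summable (fun n : ℤ => greenTerm k α x n) := by
  have h : Summable (fun n : ℤ => ‖greenTerm k α x n‖) := by
    refine Summable.of_norm_bounded_eventually
      (summable_exp_neg_mul_abs_int (half_pos (abs_pos.mpr hx))) ?_
    have htend : Filter.Tendsto (fun n : ℤ => |(n : ℝ)|) Filter.cofinite Filter.atTop :=
      tendsto_norm_cocompact_atTop.comp Int.tendsto_coe_cofinite
    filter_upwards [htend.eventually_ge_atTop (4 * (|α| + |k|) + 2)] with n hn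
    rw [norm_norm]
    exact norm_greenTerm_le hn
  exact ⟨h, h.of_norm⟩

end
end

section
/- For every x = (x₁,x₂,x₃) ∈ ℝ³ with x₃ ≠ 0, the series Σ_{(n₁,n₂)∈ℤ²} (1/β_{n₁,n₂}) exp(i α_{1,n₁} x₁ + i α_{2,n₂} x₂ + i β_{n₁,n₂} |x₃|) converges absolutely; in particular the doubly quasi-periodic Green's function G_d(x) = (i/(8π²)) Σ_{(n₁,n₂)∈ℤ²} (1/β_{n₁,n₂}) exp(i α_{1,n₁} x₁ + i α_{2,n₂} x₂ + i β_{n₁,n₂} |x₃|) is well defined at every point with x₃ ≠ 0. -/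
open MeasureTheory Complex Real

noncomputable section

/-- β_{n₁,n₂} = √(k² − α_{1,n₁}² − α_{2,n₂}²) if α_{1,n₁}² + α_{2,n₂}² ≤ k²,
and i√(α_{1,n₁}² + α_{2,n₂}² − k²) otherwise, where α_{i,nᵢ} = αᵢ + nᵢ. -/
def betaCoef3 (k α₁ α₂ : ℝ) (n : ℤ × ℤ) : ℂ :=
  if (α₁ + (n.1 : ℝ)) ^ 2 + (α₂ + (n.2 : ℝ)) ^ 2 ≤ k ^ 2 then
    ((Real.sqrt (k ^ 2 - (α₁ + (n.1 : ℝ)) ^ 2 - (α₂ + (n.2 : ℝ)) ^ 2) : ℝ) : ℂ)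
  else Complex.I * ((Real.sqrt ((α₁ + (n.1 : ℝ)) ^ 2 + (α₂ + (n.2 : ℝ)) ^ 2 - k ^ 2) : ℝ) : ℂ)

/-- The general term of the eigenfunction expansion of the doubly quasi-periodic
Green's function. -/
def greenTerm3 (k α₁ α₂ : ℝ) (x : EuclideanSpace ℝ (Fin 3)) (n : ℤ × ℤ) : ℂ :=
  (1 / betaCoef3 k α₁ α₂ n) *
    Complex.exp (Complex.I * ((α₁ + (n.1 : ℝ) : ℝ) : ℂ) * (x 0 : ℂ) +
      Complex.I * ((α₂ + (n.2 : ℝ) : ℝ) : ℂ) * (x 1 : ℂ) +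
      Complex.I * betaCoef3 k α₁ α₂ n * ((|x 2| : ℝ) : ℂ))

/-- The doubly quasi-periodic Green's function
G_d(x) = (i/(8π²)) Σ_{(n₁,n₂)} (1/β_{n₁,n₂}) e^{iα_{1,n₁}x₁+iα_{2,n₂}x₂+iβ_{n₁,n₂}|x₃|}. -/
def greenGd (k α₁ α₂ : ℝ) (x : EuclideanSpace ℝ (Fin 3)) : ℂ :=
  (Complex.I / (8 * (π : ℂ) ^ 2)) * ∑' n : ℤ × ℤ, greenTerm3 k α₁ α₂ x n

theorem summable_exp_neg_mul_abs_add_int {c : ℝ} (hc : 0 < c) (a : ℝ) :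
    Summable fun n : ℤ => Real.exp (-c * |a + n|) := by
  have hgeom : Summable fun n : ℕ => Real.exp (n * -c) :=
    Real.summable_exp_nat_mul_iff.mpr (by linarith)
  have hint : Summable fun n : ℤ => Real.exp (|(n : ℝ)| * -c) :=
    Summable.of_nat_of_neg (by simpa using hgeom) (by simpa using hgeom)
  refine (hint.mul_left (Real.exp (c * |a|))).of_nonneg_of_le (fun n => (Real.exp_pos _).le)
    fun n => ?_
  rw [← Real.exp_add, Real.exp_le_exp]
  have habs : |(n : ℝ)| ≤ |a + n| + |a| := by
    simpa using abs_sub (a + n) a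
  nlinarith

theorem le_im_betaCoef3 {k : ℝ} (hk : 0 < k) (α₁ α₂ : ℝ) (n : ℤ × ℤ) :
    (|α₁ + n.1| + |α₂ + n.2|) / 2 - k ≤ (betaCoef3 k α₁ α₂ n).im := by
  have h₁ := sq_abs (α₁ + (n.1 : ℝ))
  have h₂ := sq_abs (α₂ + (n.2 : ℝ))
  have h₁' := abs_nonneg (α₁ + (n.1 : ℝ))
  have h₂' := abs_nonneg (α₂ + (n.2 : ℝ))
  unfold betaCoef3
  split_ifs with h
  · rw [Complex.ofReal_im]
    nlinarith [abs_le_of_sq_le_sq' (h₁.le.trans (by nlinarith)) hk.le,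
      abs_le_of_sq_le_sq' (h₂.le.trans (by nlinarith)) hk.le]
  · rw [Complex.I_mul_im, Complex.ofReal_re]
    rcases le_total ((|α₁ + (n.1 : ℝ)| + |α₂ + n.2|) / 2) k with h' | h'
    · exact (sub_nonpos.mpr h').trans (Real.sqrt_nonneg _)
    · apply Real.le_sqrt_of_sq_le
      nlinarith [sq_nonneg (|α₁ + (n.1 : ℝ)| - |α₂ + n.2|)]

theorem norm_greenTerm3 (k α₁ α₂ : ℝ) (x : EuclideanSpace ℝ (Fin 3)) (n : ℤ × ℤ) :
    ‖greenTerm3 k α₁ α₂ x n‖ =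
      ‖betaCoef3 k α₁ α₂ n‖⁻¹ * Real.exp (-(betaCoef3 k α₁ α₂ n).im * |x 2|) := by
  rw [greenTerm3, norm_mul, Complex.norm_exp, one_div, norm_inv]
  congr 2
  simp

/-- For every x with x₃ ≠ 0, the series defining the doubly quasi-periodic Green's
function converges absolutely; in particular G_d is well defined there. -/
theorem statement1 (k α₁ α₂ : ℝ) (hk : 0 < k) (b : ℝ) (hb : 0 < b)
    (hβ : ∀ n : ℤ × ℤ, b ≤ ‖betaCoef3 k α₁ α₂ n‖)
    (x : EuclideanSpace ℝ (Fin 3)) (hx : x 2 ≠ 0) :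
    Summable (fun n : ℤ × ℤ => ‖greenTerm3 k α₁ α₂ x n‖) ∧
      Summable (fun n : ℤ × ℤ => greenTerm3 k α₁ α₂ x n) := by
  have hnorm : Summable fun n : ℤ × ℤ => ‖greenTerm3 k α₁ α₂ x n‖ := by
    have hc : 0 < |x 2| / 2 := half_pos (abs_pos.mpr hx)
    have hprod := (summable_exp_neg_mul_abs_add_int hc α₁).mul_of_nonneg
      (summable_exp_neg_mul_abs_add_int hc α₂) (fun _ => (Real.exp_pos _).le)
      (fun _ => (Real.exp_pos _).le)
    refine (hprod.mul_left (b⁻¹ * Real.exp (k * |x 2|))).of_nonneg_of_le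
      (fun _ => norm_nonneg _) fun n => ?_
    rw [norm_greenTerm3, mul_assoc, ← Real.exp_add, ← Real.exp_add]
    have him := mul_le_mul_of_nonneg_right (le_im_betaCoef3 hk α₁ α₂ n) (abs_nonneg (x 2))
    gcongr
    · exact hβ n
    · linarith
  exact ⟨hnorm, hnorm.of_norm⟩

end
end

section
/- For every j = (j₁,j₂) ∈ ℤ² with j ≠ (0,0), the Fourier coefficient of f₁ satisfies (j₁² + j₂²π²/c̃²) F̂_{1,j} = 1/(2√(π c̃)) + (1/(2π)) Φ̂_{1,j}, where Φ₁(x) = (2 + ln|x|) 𝒴_ε′(|x|)/|x| + 𝒴_ε″(|x|) ln|x| and Φ̂_{1,j} = ∫_{D_c̃} Φ₁(x) φ_{−j}(x) dx. -/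
open MeasureTheory Complex Real

noncomputable section

/-- The rectangle D_c̃ = [−π,π] × [−c̃,c̃]. -/
def domD (ct : ℝ) : Set (EuclideanSpace ℝ (Fin 2)) :=
  {x | x 0 ∈ Set.Icc (-π) π ∧ x 1 ∈ Set.Icc (-ct) ct}

/-- The Fourier basis φ_j(x) = (1/(2√(π c̃))) e^{i(j₁x₁ + j₂πx₂/c̃)}. -/
def fBasis (ct : ℝ) (j : ℤ × ℤ) (x : EuclideanSpace ℝ (Fin 2)) : ℂ :=
  (1 / (2 * Real.sqrt (π * ct)) : ℝ) *
    Complex.exp (Complex.I * ((j.1 : ℂ) * (x 0 : ℂ) + (j.2 : ℂ) * (π : ℂ) * (x 1 : ℂ) / (ct : ℂ)))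

/-- The j-th Fourier coefficient ĝ_j = ∫_{D_c̃} g(x) φ_{−j}(x) dx. -/
def fourierCoef (ct : ℝ) (g : EuclideanSpace ℝ (Fin 2) → ℂ) (j : ℤ × ℤ) : ℂ :=
  ∫ x in domD ct, g x * fBasis ct (-j) x

/-- f₁(x) = −(1/(2π)) ln|x| · 𝒴_ε(|x|). -/
def funF1 (𝒴 : ℝ → ℝ) (x : EuclideanSpace ℝ (Fin 2)) : ℝ :=
  -(1 / (2 * π)) * Real.log ‖x‖ * 𝒴 ‖x‖

/-- Φ₁(x) = (2 + ln|x|) 𝒴_ε′(|x|)/|x| + 𝒴_ε″(|x|) ln|x|. -/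
def funPhi1 (𝒴 : ℝ → ℝ) (x : EuclideanSpace ℝ (Fin 2)) : ℝ :=
  (2 + Real.log ‖x‖) * deriv 𝒴 ‖x‖ / ‖x‖ + deriv (deriv 𝒴) ‖x‖ * Real.log ‖x‖

/-- The strip `(0, ∞) × (-π, π)` of polar coordinates of the plane. -/
def polarStrip : Set (ℝ × ℝ) := Set.Ioi 0 ×ˢ Set.Ioo (-π) π

/-- The linear phase `p x₁ + q x₂` at the point of the unit circle with angle `θ`. -/
def circlePhase (p q θ : ℝ) : ℝ := p * Real.cos θ + q * Real.sin θ

/-- The plane wave `exp (-i (p x₁ + q x₂))` in polar coordinates. -/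
def polarWave (p q r θ : ℝ) : ℂ := Complex.exp (-(I * (r : ℂ) * (circlePhase p q θ : ℂ)))

lemma continuous_circlePhase (p q : ℝ) : Continuous (circlePhase p q) := by
  unfold circlePhase; fun_prop

lemma continuous_polarWave (p q : ℝ) :
    Continuous fun z : ℝ × ℝ => polarWave p q z.1 z.2 := by
  have := continuous_circlePhase p q
  unfold polarWave; fun_prop

lemma hasDerivAt_circlePhase (p q θ : ℝ) :
    HasDerivAt (circlePhase p q) (circlePhase q (-p) θ) θ := by
  have := ((Real.hasDerivAt_cos θ).const_mul p).add ((Real.hasDerivAt_sin θ).const_mul q)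
  exact this.congr_deriv (by simp only [circlePhase]; ring)

lemma circlePhase_neg_neg (p q θ : ℝ) : circlePhase (-p) (-q) θ = -circlePhase p q θ := by
  simp only [circlePhase]; ring

lemma circlePhase_sq_add_sq (p q θ : ℝ) :
    circlePhase p q θ ^ 2 + circlePhase q (-p) θ ^ 2 = p ^ 2 + q ^ 2 := by
  simp only [circlePhase]
  linear_combination (p ^ 2 + q ^ 2) * Real.sin_sq_add_cos_sq θ

lemma hasDerivAt_polarWave_radius (p q r θ : ℝ) :
    HasDerivAt (fun s => polarWave p q s θ) (-(I * circlePhase p q θ) * polarWave p q r θ) r := by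
  have h := ((((hasDerivAt_id r).ofReal_comp).const_mul I).mul_const
    (circlePhase p q θ : ℂ)).neg.cexp
  refine h.congr_deriv ?_
  simp only [polarWave, id, Pi.neg_apply]; push_cast; ring

lemma hasDerivAt_polarWave_angle (p q r θ : ℝ) :
    HasDerivAt (fun t => polarWave p q r t)
      (-(I * r * circlePhase q (-p) θ) * polarWave p q r θ) θ := by
  have h := (((hasDerivAt_circlePhase p q θ).ofReal_comp).const_mul (I * (r : ℂ))).neg.cexp
  refine h.congr_deriv ?_
  simp only [polarWave, Pi.neg_apply]; ring

/-- The angular mean of a plane wave solves the radial Helmholtz equation. -/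
lemma integral_angle_helmholtz (p q r : ℝ) :
    ∫ θ in Set.Ioo (-π) π, (-(I * circlePhase p q θ) - r * (circlePhase p q θ : ℂ) ^ 2
      + ((p ^ 2 + q ^ 2 : ℝ) : ℂ) * r) * polarWave p q r θ = 0 := by
  have hcont := continuous_circlePhase p q
  have hW : Continuous (polarWave p q r) :=
    (continuous_polarWave p q).comp (Continuous.prodMk_right r)
  have hderiv : ∀ θ ∈ Set.uIcc (-π) π,
      HasDerivAt (fun t => I * (circlePhase q (-p) t : ℂ) * polarWave p q r t)
        ((-(I * circlePhase p q θ) - r * (circlePhase p q θ : ℂ) ^ 2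
          + ((p ^ 2 + q ^ 2 : ℝ) : ℂ) * r) * polarWave p q r θ) θ := by
    intro θ _
    have h := (((hasDerivAt_circlePhase q (-p) θ).ofReal_comp).const_mul I).mul
      (hasDerivAt_polarWave_angle p q r θ)
    refine h.congr_deriv ?_
    rw [circlePhase_neg_neg, ← circlePhase_sq_add_sq p q θ]
    push_cast
    linear_combination (-(r * (circlePhase q (-p) θ : ℂ) ^ 2) * polarWave p q r θ) * I_sq
  rw [← integral_Ioc_eq_integral_Ioo, ← intervalIntegral.integral_of_le (by linarith [pi_pos]),
    intervalIntegral.integral_eq_sub_of_hasDerivAt hderiv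
      (Continuous.intervalIntegrable (by fun_prop) _ _)]
  simp [polarWave, circlePhase]

/-- A radially compactly supported function with a logarithmic singularity is integrable. -/
lemma integrableOn_polarStrip_log {A B : ℝ × ℝ → ℂ} (hA : Continuous A) (hB : Continuous B)
    {R : ℝ} (hA0 : ∀ z, R < z.1 → A z = 0) (hB0 : ∀ z, R < z.1 → B z = 0) :
    IntegrableOn (fun z => (Real.log z.1 : ℂ) * A z + B z) polarStrip := by
  have hK : IsCompact (Set.Icc 0 R ×ˢ Set.Icc (-π) π) := isCompact_Icc.prod isCompact_Icc
  have hsub : Set.Ioc 0 R ×ˢ Set.Ioo (-π) π ⊆ Set.Icc 0 R ×ˢ Set.Icc (-π) π :=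
    Set.prod_mono Set.Ioc_subset_Icc_self Set.Ioo_subset_Icc_self
  have hmeas : MeasurableSet (Set.Ioc 0 R ×ˢ Set.Ioo (-π) π) :=
    measurableSet_Ioc.prod measurableSet_Ioo
  have hlog : IntegrableOn (fun r : ℝ => (Real.log r : ℂ)) (Set.Ioc 0 R) := by
    have h : IntervalIntegrable Real.log volume 0 R := intervalIntegral.intervalIntegrable_log'
    exact h.1.ofReal
  have hlog2 : IntegrableOn (fun z : ℝ × ℝ => (Real.log z.1 : ℂ))
      (Set.Ioc 0 R ×ˢ Set.Ioo (-π) π) := by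
    rw [IntegrableOn, Measure.volume_eq_prod, ← Measure.prod_restrict]
    exact Integrable.comp_fst hlog _
  have h1 := hlog2.mul_continuousOn_of_subset hA.continuousOn hmeas hK hsub
  have h2 : IntegrableOn B (Set.Ioc 0 R ×ˢ Set.Ioo (-π) π) :=
    (hB.continuousOn.integrableOn_compact hK).mono_set hsub
  refine (h1.add h2).of_forall_sdiff_eq_zero (measurableSet_Ioi.prod measurableSet_Ioo) ?_
  rintro ⟨r, θ⟩ ⟨⟨hr, hθ⟩, hn⟩
  have hRr : R < r := by
    by_contra! h
    exact hn ⟨⟨hr, h⟩, hθ⟩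
  simp [hA0 (r, θ) hRr, hB0 (r, θ) hRr]

lemma deriv_eq_zero_of_forall_gt {f : ℝ → ℝ} {R : ℝ} (hf : ∀ t, R < t → f t = 0) :
    ∀ t, R < t → deriv f t = 0 := by
  intro t ht
  have h : f =ᶠ[nhds t] fun _ => 0 := by
    filter_upwards [lt_mem_nhds ht] with s hs using hf s hs
  rw [h.deriv_eq, deriv_const]

/-- Green's identity along a ray for `Y(r) log r` against a plane wave. -/
lemma integral_radius_green {Y : ℝ → ℝ} (hY : ContDiff ℝ 2 Y) (hY1 : Y 0 = 1) {R : ℝ}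
    (hY0 : ∀ t, R < t → Y t = 0) (p q θ : ℝ)
    (hint : IntegrableOn (fun r : ℝ => (-(Real.log r * Y r : ℂ) *
        (-(I * circlePhase p q θ) - r * (circlePhase p q θ : ℂ) ^ 2)
      + ((2 + Real.log r) * deriv Y r + r * deriv (deriv Y) r * Real.log r)) *
        polarWave p q r θ) (Set.Ioi 0)) :
    ∫ r in Set.Ioi (0 : ℝ), (-(Real.log r * Y r : ℂ) *
        (-(I * circlePhase p q θ) - r * (circlePhase p q θ : ℂ) ^ 2)
      + ((2 + Real.log r) * deriv Y r + r * deriv (deriv Y) r * Real.log r)) *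
        polarWave p q r θ = -1 := by
  have hd1 : Differentiable ℝ Y := hY.differentiable (by norm_num)
  have hY' : ContDiff ℝ 1 (deriv Y) := (contDiff_succ_iff_deriv.1 hY).2.2
  have hd2 : Differentiable ℝ (deriv Y) := hY'.differentiable (by norm_num)
  have hY0' := deriv_eq_zero_of_forall_gt hY0
  have hW : Continuous (fun r => polarWave p q r θ) :=
    (continuous_polarWave p q).comp (Continuous.prodMk_left θ)
  let H : ℝ → ℂ := fun r => (((Y r + (r * Real.log r) * deriv Y r : ℝ) : ℂ)
    + I * circlePhase p q θ * ((Y r * (r * Real.log r) : ℝ) : ℂ)) * polarWave p q r θ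
  have hHcont : Continuous H := by
    have h1 := Real.continuous_mul_log
    have h2 := hd1.continuous
    have h3 := hd2.continuous
    dsimp only [H]
    fun_prop
  have hlim : Filter.Tendsto H Filter.atTop (nhds 0) := by
    refine tendsto_const_nhds.congr' ?_
    filter_upwards [Filter.eventually_gt_atTop R] with r hr
    simp [H, hY0 r hr, hY0' r hr]
  rw [integral_Ioi_of_hasDerivAt_of_tendsto hHcont.continuousWithinAt ?_ hint hlim]
  · simp [H, hY1, polarWave]
  · intro r hr
    have hr0 : r ≠ 0 := ne_of_gt hr
    have hl := Real.hasDerivAt_mul_log hr0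
    have h1 := ((hd1 r).hasDerivAt.add (hl.mul (hd2 r).hasDerivAt)).ofReal_comp
    have h2 := (((hd1 r).hasDerivAt.mul hl).ofReal_comp).const_mul (I * (circlePhase p q θ : ℂ))
    refine ((h1.add h2).mul (hasDerivAt_polarWave_radius p q r θ)).congr_deriv ?_
    simp only [Pi.add_apply, Pi.mul_apply]
    push_cast
    linear_combination (-(Y r * r * Real.log r * (circlePhase p q θ : ℂ) ^ 2) *
      polarWave p q r θ) * I_sq

lemma integral_polarStrip_green {Y : ℝ → ℝ} (hY : ContDiff ℝ 2 Y) (hY1 : Y 0 = 1) {R : ℝ}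
    (hY0 : ∀ t, R < t → Y t = 0) (p q : ℝ) :
    ∫ z in polarStrip, (((p ^ 2 + q ^ 2 : ℝ) : ℂ) * (z.1 * Real.log z.1 * Y z.1)
      + ((2 + Real.log z.1) * deriv Y z.1 + z.1 * deriv (deriv Y) z.1 * Real.log z.1)) *
        polarWave p q z.1 z.2 = -(2 * π) := by
  have c0 := hY.continuous
  have hY' : ContDiff ℝ 1 (deriv Y) := (contDiff_succ_iff_deriv.1 hY).2.2
  have c1 := hY'.continuous
  have c2 : Continuous (deriv (deriv Y)) := hY'.continuous_deriv (le_refl _)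
  have hY0' := deriv_eq_zero_of_forall_gt hY0
  have hY0'' := deriv_eq_zero_of_forall_gt hY0'
  have cp := continuous_circlePhase p q
  have cW := continuous_polarWave p q
  let G₁ : ℝ × ℝ → ℂ := fun z => (-(Real.log z.1 * Y z.1 : ℂ) *
        (-(I * circlePhase p q z.2) - z.1 * (circlePhase p q z.2 : ℂ) ^ 2)
      + ((2 + Real.log z.1) * deriv Y z.1 + z.1 * deriv (deriv Y) z.1 * Real.log z.1)) *
        polarWave p q z.1 z.2
  let G₂ : ℝ × ℝ → ℂ := fun z => (Real.log z.1 * Y z.1 : ℂ) *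
    ((-(I * circlePhase p q z.2) - z.1 * (circlePhase p q z.2 : ℂ) ^ 2
      + ((p ^ 2 + q ^ 2 : ℝ) : ℂ) * z.1) * polarWave p q z.1 z.2)
  have i₁ : IntegrableOn G₁ polarStrip := by
    have h := integrableOn_polarStrip_log (R := R)
      (A := fun z => (-(Y z.1 : ℂ) *
        (-(I * circlePhase p q z.2) - z.1 * (circlePhase p q z.2 : ℂ) ^ 2)
        + (deriv Y z.1 + z.1 * deriv (deriv Y) z.1)) * polarWave p q z.1 z.2)
      (B := fun z => 2 * deriv Y z.1 * polarWave p q z.1 z.2) (by fun_prop) (by fun_prop)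
      (fun z hz => by simp [hY0 _ hz, hY0' _ hz, hY0'' _ hz])
      (fun z hz => by simp [hY0' _ hz])
    refine h.congr_fun (fun z _ => ?_) (measurableSet_Ioi.prod measurableSet_Ioo)
    simp only [G₁]; ring
  have i₂ : IntegrableOn G₂ polarStrip := by
    have h := integrableOn_polarStrip_log (R := R)
      (A := fun z => (Y z.1 : ℂ) *
        ((-(I * circlePhase p q z.2) - z.1 * (circlePhase p q z.2 : ℂ) ^ 2
          + ((p ^ 2 + q ^ 2 : ℝ) : ℂ) * z.1) * polarWave p q z.1 z.2))
      (B := fun _ => 0) (by fun_prop) (by fun_prop)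
      (fun z hz => by simp [hY0 _ hz]) (fun z hz => rfl)
    refine h.congr_fun (fun z _ => ?_) (measurableSet_Ioi.prod measurableSet_Ioo)
    simp only [G₂]; ring
  have e₂ : ∫ z in polarStrip, G₂ z = 0 := by
    rw [Measure.volume_eq_prod] at i₂ ⊢
    rw [polarStrip, setIntegral_prod _ i₂]
    simp only [G₂, integral_const_mul, integral_angle_helmholtz, mul_zero, integral_zero]
  have e₁ : ∫ z in polarStrip, G₁ z = -(2 * π) := by
    have i₁' := i₁
    rw [IntegrableOn, Measure.volume_eq_prod, polarStrip, ← Measure.prod_restrict] at i₁'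
    rw [Measure.volume_eq_prod, polarStrip, ← Measure.prod_restrict, integral_prod_symm _ i₁']
    have : ∀ᵐ θ ∂(volume.restrict (Set.Ioo (-π) π)),
        ∫ r in Set.Ioi (0 : ℝ), G₁ (r, θ) = -1 := by
      filter_upwards [i₁'.prod_left_ae] with θ hθ
      exact integral_radius_green hY hY1 hY0 p q θ hθ
    rw [integral_congr_ae this, setIntegral_const, measureReal_def, Real.volume_Ioo,
      ENNReal.toReal_ofReal (by linarith [pi_pos]), Complex.real_smul]
    push_cast; ring
  calc _ = ∫ z in polarStrip, (G₁ z + G₂ z) := by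
        congr 1; ext z; simp only [G₁, G₂]; ring
    _ = _ := by rw [integral_add i₁ i₂, e₁, e₂, add_zero]

/-- Integration over the Euclidean plane in polar coordinates. -/
lemma integral_euclideanSpace_eq_polarStrip (F : EuclideanSpace ℝ (Fin 2) → ℂ) :
    ∫ x, F x = ∫ z in polarStrip,
      (z.1 : ℂ) * F !₂[z.1 * Real.cos z.2, z.1 * Real.sin z.2] := by
  have h1 := (PiLp.volume_preserving_toLp (Fin 2)).integral_comp
    (MeasurableEquiv.toLp 2 (Fin 2 → ℝ)).measurableEmbedding F
  have h2 := (volume_preserving_finTwoArrow ℝ).symm.integral_comp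
    MeasurableEquiv.finTwoArrow.symm.measurableEmbedding (fun v => F (WithLp.toLp 2 v))
  rw [← h1, ← h2, ← integral_comp_polarCoord_symm]
  rfl

lemma norm_polar {r θ : ℝ} (hr : 0 < r) :
    ‖(!₂[r * Real.cos θ, r * Real.sin θ] : EuclideanSpace ℝ (Fin 2))‖ = r := by
  rw [EuclideanSpace.norm_eq, Real.sqrt_eq_iff_mul_self_eq (by positivity) hr.le]
  simp only [Fin.sum_univ_two, Real.norm_eq_abs, sq_abs]
  simp only [Matrix.cons_val_zero, Matrix.cons_val_one]
  linear_combination (r ^ 2) * Real.sin_sq_add_cos_sq θ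

lemma fBasis_polar (ct : ℝ) (j : ℤ × ℤ) (r θ : ℝ) :
    fBasis ct (-j) !₂[r * Real.cos θ, r * Real.sin θ] =
      ((1 / (2 * Real.sqrt (π * ct)) : ℝ) : ℂ) * polarWave j.1 (j.2 * π / ct) r θ := by
  simp only [fBasis, polarWave, circlePhase]
  congr 2
  simp
  ring

/-- The Fourier coefficient of a radial function supported in a disc inside the cell. -/
lemma fourierCoef_radial {ct R : ℝ} (hRπ : R ≤ π) (hRct : R ≤ ct) {h : ℝ → ℝ}
    (h0 : ∀ t, R < t → h t = 0) (j : ℤ × ℤ) :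
    fourierCoef ct (fun x => ((h ‖x‖ : ℝ) : ℂ)) j =
      ((1 / (2 * Real.sqrt (π * ct)) : ℝ) : ℂ) *
        ∫ z in polarStrip, ((z.1 * h z.1 : ℝ) : ℂ) * polarWave j.1 (j.2 * π / ct) z.1 z.2 := by
  rw [fourierCoef, setIntegral_eq_integral_of_forall_compl_eq_zero,
    integral_euclideanSpace_eq_polarStrip, ← integral_const_mul]
  · refine setIntegral_congr_fun (measurableSet_Ioi.prod measurableSet_Ioo) fun z hz => ?_
    simp only [fBasis_polar, norm_polar hz.1]
    push_cast; ring
  · intro x hx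
    suffices R < ‖x‖ by simp [h0 _ this]
    by_contra! hle
    have h1 := abs_le.1 ((PiLp.norm_apply_le x 0).trans hle)
    have h2 := abs_le.1 ((PiLp.norm_apply_le x 1).trans hle)
    exact hx ⟨⟨by linarith, by linarith⟩, ⟨by linarith, by linarith⟩⟩

/-- For j ≠ (0,0): (j₁² + j₂²π²/c̃²) F̂_{1,j} = 1/(2√(πc̃)) + (1/(2π)) Φ̂_{1,j}. -/
theorem statement4 (c ct ε : ℝ) (hc : 0 < c) (hcct : c < ct)
    (hε : 0 < ε) (hε' : ε < min 1 ct / 2)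
    (𝒴 : ℝ → ℝ) (h𝒴 : ContDiff ℝ (⊤ : ℕ∞) 𝒴)
    (h𝒴1 : ∀ t : ℝ, t ≤ ε → 𝒴 t = 1)
    (h𝒴0 : ∀ t : ℝ, 2 * ε ≤ t → 𝒴 t = 0)
    (j : ℤ × ℤ) (hj : j ≠ (0, 0)) :
    (((j.1 : ℝ) ^ 2 + (j.2 : ℝ) ^ 2 * π ^ 2 / ct ^ 2 : ℝ) : ℂ) *
        fourierCoef ct (fun x => ((funF1 𝒴 x : ℝ) : ℂ)) j =
      ((1 / (2 * Real.sqrt (π * ct)) : ℝ) : ℂ) +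
        ((1 / (2 * π) : ℝ) : ℂ) * fourierCoef ct (fun x => ((funPhi1 𝒴 x : ℝ) : ℂ)) j := by
  have hmin1 : 2 * ε < 1 := by linarith [min_le_left (1 : ℝ) ct]
  have hminct : 2 * ε < ct := by linarith [min_le_right (1 : ℝ) ct]
  have hRπ : 2 * ε ≤ π := by linarith [Real.pi_gt_three]
  have hY : ContDiff ℝ 2 𝒴 := contDiff_infty.1 h𝒴 2
  have hY0 : ∀ t, 2 * ε < t → 𝒴 t = 0 := fun t ht => h𝒴0 t ht.le
  have hY0' := deriv_eq_zero_of_forall_gt hY0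
  have hY0'' := deriv_eq_zero_of_forall_gt hY0'
  have hY' : ContDiff ℝ 1 (deriv 𝒴) := (contDiff_succ_iff_deriv.1 hY).2.2
  have c0 := hY.continuous
  have c1 := hY'.continuous
  have c2 : Continuous (deriv (deriv 𝒴)) := hY'.continuous_deriv (le_refl _)
  have cW := continuous_polarWave j.1 (j.2 * π / ct)
  have hF := fourierCoef_radial hRπ hminct.le
    (h := fun t => -(1 / (2 * π)) * Real.log t * 𝒴 t) (fun t ht => by simp [hY0 t ht]) j
  have hΦ := fourierCoef_radial hRπ hminct.le
    (h := fun t => (2 + Real.log t) * deriv 𝒴 t / t + deriv (deriv 𝒴) t * Real.log t)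
    (fun t ht => by simp [hY0' t ht, hY0'' t ht]) j
  have iF : IntegrableOn (fun z : ℝ × ℝ => ((z.1 * Real.log z.1 * 𝒴 z.1 : ℝ) : ℂ) *
      polarWave j.1 (j.2 * π / ct) z.1 z.2) polarStrip := by
    have h := integrableOn_polarStrip_log (R := 2 * ε)
      (A := fun z => z.1 * 𝒴 z.1 * polarWave j.1 (j.2 * π / ct) z.1 z.2)
      (B := fun _ => 0) (by fun_prop) (by fun_prop)
      (fun z hz => by simp [hY0 _ hz]) (fun z hz => rfl)
    refine h.congr_fun (fun z _ => ?_) (measurableSet_Ioi.prod measurableSet_Ioo)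
    push_cast; ring
  have iΦ : IntegrableOn (fun z : ℝ × ℝ => (((2 + Real.log z.1) * deriv 𝒴 z.1
      + z.1 * deriv (deriv 𝒴) z.1 * Real.log z.1 : ℝ) : ℂ) *
      polarWave j.1 (j.2 * π / ct) z.1 z.2) polarStrip := by
    have h := integrableOn_polarStrip_log (R := 2 * ε)
      (A := fun z => (deriv 𝒴 z.1 + z.1 * deriv (deriv 𝒴) z.1) *
        polarWave j.1 (j.2 * π / ct) z.1 z.2)
      (B := fun z => 2 * deriv 𝒴 z.1 * polarWave j.1 (j.2 * π / ct) z.1 z.2)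
      (by fun_prop) (by fun_prop)
      (fun z hz => by simp [hY0' _ hz, hY0'' _ hz]) (fun z hz => by simp [hY0' _ hz])
    refine h.congr_fun (fun z _ => ?_) (measurableSet_Ioi.prod measurableSet_Ioo)
    push_cast; ring
  have eF : ∫ z in polarStrip, ((z.1 * (-(1 / (2 * π)) * Real.log z.1 * 𝒴 z.1) : ℝ) : ℂ) *
      polarWave j.1 (j.2 * π / ct) z.1 z.2 = ((-(1 / (2 * π)) : ℝ) : ℂ) *
      ∫ z in polarStrip, ((z.1 * Real.log z.1 * 𝒴 z.1 : ℝ) : ℂ) *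
        polarWave j.1 (j.2 * π / ct) z.1 z.2 := by
    rw [← integral_const_mul]
    congr 1; ext z; push_cast; ring
  have eΦ : ∫ z in polarStrip, ((z.1 * ((2 + Real.log z.1) * deriv 𝒴 z.1 / z.1
      + deriv (deriv 𝒴) z.1 * Real.log z.1) : ℝ) : ℂ) *
      polarWave j.1 (j.2 * π / ct) z.1 z.2 =
      ∫ z in polarStrip, (((2 + Real.log z.1) * deriv 𝒴 z.1
      + z.1 * deriv (deriv 𝒴) z.1 * Real.log z.1 : ℝ) : ℂ) *
      polarWave j.1 (j.2 * π / ct) z.1 z.2 := by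
    refine setIntegral_congr_fun (measurableSet_Ioi.prod measurableSet_Ioo) fun z hz => ?_
    have hz0 : z.1 ≠ 0 := ne_of_gt hz.1
    congr 2
    field_simp
  have key := integral_polarStrip_green hY (h𝒴1 0 hε.le) hY0 j.1 (j.2 * π / ct)
  have split : ∫ z in polarStrip, ((((j.1 : ℝ) ^ 2 + (j.2 * π / ct) ^ 2 : ℝ) : ℂ) *
      (z.1 * Real.log z.1 * 𝒴 z.1) + ((2 + Real.log z.1) * deriv 𝒴 z.1
      + z.1 * deriv (deriv 𝒴) z.1 * Real.log z.1)) * polarWave j.1 (j.2 * π / ct) z.1 z.2 =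
      (((j.1 : ℝ) ^ 2 + (j.2 * π / ct) ^ 2 : ℝ) : ℂ) *
      (∫ z in polarStrip, ((z.1 * Real.log z.1 * 𝒴 z.1 : ℝ) : ℂ) *
        polarWave j.1 (j.2 * π / ct) z.1 z.2) +
      ∫ z in polarStrip, (((2 + Real.log z.1) * deriv 𝒴 z.1
      + z.1 * deriv (deriv 𝒴) z.1 * Real.log z.1 : ℝ) : ℂ) *
      polarWave j.1 (j.2 * π / ct) z.1 z.2 := by
    rw [← integral_const_mul, ← integral_add (iF.const_mul _) iΦ]
    congr 1; ext z; push_cast; ring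
  rw [split] at key
  have hK : (j.1 : ℝ) ^ 2 + (j.2 : ℝ) ^ 2 * π ^ 2 / ct ^ 2 =
      (j.1 : ℝ) ^ 2 + (j.2 * π / ct) ^ 2 := by ring
  rw [eF] at hF
  rw [eΦ] at hΦ
  simp only [funF1, funPhi1]
  rw [hF, hΦ, hK]
  have hπ : ((1 / (2 * π) : ℝ) : ℂ) * (2 * π) = 1 := by
    have : (π : ℂ) ≠ 0 := by exact_mod_cast pi_ne_zero
    push_cast; field_simp
  rw [ofReal_neg]
  linear_combination (-((1 / (2 * Real.sqrt (π * ct)) : ℝ) : ℂ) * ((1 / (2 * π) : ℝ) : ℂ)) * key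
    + ((1 / (2 * Real.sqrt (π * ct)) : ℝ) : ℂ) * hπ

end
end

section
/- For every j = (j₁,j₂) ∈ ℤ² with j ≠ (0,0), the Fourier coefficient of f₂ satisfies (j₁² + j₂²π²/c̃²) F̂_{2,j} = −2 i j₁ F̂_{1,j} + (1/(2π)) Φ̂_{2,j}, where Φ₁(x) = (2 + ln|x|) 𝒴_ε′(|x|)/|x| + 𝒴_ε″(|x|) ln|x|, Φ₂(x) = x₁ Φ₁(x), and Φ̂_{2,j} = ∫_{D_c̃} Φ₂(x) φ_{−j}(x) dx. -/
open MeasureTheory Complex Real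

noncomputable section

/-- f₂(x) = −(1/(2π)) x₁ ln|x| · 𝒴_ε(|x|). -/
def funF2 (𝒴 : ℝ → ℝ) (x : EuclideanSpace ℝ (Fin 2)) : ℝ :=
  -(1 / (2 * π)) * x 0 * Real.log ‖x‖ * 𝒴 ‖x‖

/-- Φ₂(x) = x₁ Φ₁(x). -/
def funPhi2 (𝒴 : ℝ → ℝ) (x : EuclideanSpace ℝ (Fin 2)) : ℝ :=
  x 0 * funPhi1 𝒴 x

/-- The reciprocal square root is integrable near the origin. -/
theorem integrable_indicator_inv_sqrt_abs :
    Integrable ((Set.Ioc (-1 : ℝ) 1).indicator fun x => (√|x|)⁻¹) := by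
  rw [integrable_indicator_iff measurableSet_Ioc,
    ← intervalIntegrable_iff_integrableOn_Ioc_of_le (by norm_num)]
  have h : IntervalIntegrable (fun x : ℝ => x ^ (-(1 / 2) : ℝ)) volume (-1) 1 :=
    intervalIntegral.intervalIntegrable_rpow' (by norm_num)
  have h' : IntervalIntegrable (fun x : ℝ => (-x) ^ (-(1 / 2) : ℝ)) volume (-1) 1 := by
    have := (h.comp_sub_left 0).symm
    simpa using this
  have hcos : Real.cos (-(1 / 2) * π) = 0 := by
    rw [show -(1 / 2) * π = -(π / 2) by ring, Real.cos_neg, Real.cos_pi_div_two]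
  refine (h.add h').congr fun x _ => ?_
  rcases lt_trichotomy x 0 with hx | hx | hx
  · rw [Real.rpow_def_of_neg hx, hcos, abs_of_neg hx, Real.rpow_neg (by linarith),
      Real.sqrt_eq_rpow]
    simp
  · subst hx
    simp
  · rw [Real.rpow_def_of_neg (neg_lt_zero.2 hx), hcos, abs_of_pos hx, Real.rpow_neg hx.le,
      Real.sqrt_eq_rpow]
    simp

/-- A planar function supported in the unit disc and bounded by a multiple of the reciprocal of
the distance to the origin is integrable. -/
theorem integrable_of_norm_mul_sqrt_le {f : ℝ × ℝ → ℂ} (hf : AEStronglyMeasurable f) (C : ℝ)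
    (hb : ∀ x y : ℝ, 0 < x ^ 2 + y ^ 2 → x ^ 2 + y ^ 2 < 1 →
      ‖f (x, y)‖ * √(x ^ 2 + y ^ 2) ≤ C)
    (h0 : ∀ x y : ℝ, 1 ≤ x ^ 2 + y ^ 2 → f (x, y) = 0) : Integrable f := by
  have hk := integrable_indicator_inv_sqrt_abs
  have hC : 0 ≤ C := le_trans (by positivity) (hb (1 / 2) 0 (by norm_num) (by norm_num))
  refine ((hk.mul_prod hk).const_mul C).mono' hf ?_
  have hne : ∀ᵐ x : ℝ, x ≠ 0 := by simp [ae_iff]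
  filter_upwards [Measure.quasiMeasurePreserving_fst.ae hne,
    Measure.quasiMeasurePreserving_snd.ae hne]
  rintro ⟨x, y⟩ hx hy
  simp only at hx hy ⊢
  have hk0 : ∀ x, 0 ≤ (Set.Ioc (-1 : ℝ) 1).indicator (fun x => (√|x|)⁻¹) x := fun x =>
    Set.indicator_nonneg (fun x _ => by positivity) x
  rcases lt_or_ge (x ^ 2 + y ^ 2) 1 with hs | hs
  · have hxm : x ∈ Set.Ioc (-1 : ℝ) 1 := ⟨by nlinarith, by nlinarith⟩
    have hym : y ∈ Set.Ioc (-1 : ℝ) 1 := ⟨by nlinarith, by nlinarith⟩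
    rw [Set.indicator_of_mem hxm, Set.indicator_of_mem hym, ← mul_inv,
      ← Real.sqrt_mul (abs_nonneg x), ← div_eq_mul_inv]
    have hpos : 0 < |x| * |y| := by positivity
    rw [le_div_iff₀ (Real.sqrt_pos.2 hpos)]
    refine le_trans ?_ (hb x y (by positivity) hs)
    gcongr
    nlinarith [sq_abs x, sq_abs y, sq_nonneg (|x| - |y|)]
  · rw [h0 x y hs, norm_zero]
    exact mul_nonneg hC (mul_nonneg (hk0 x) (hk0 y))

/-- If `D` is the partial derivative in the first variable, off one line, of a function with
bounded support, then the integral of `D` vanishes. -/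
theorem integral_eq_zero_of_hasDerivAt_fst {W D : ℝ × ℝ → ℂ} (hD : Integrable D)
    (hderiv : ∀ y ≠ 0, ∀ x, HasDerivAt (fun x => W (x, y)) (D (x, y)) x)
    (hW : ∀ x y : ℝ, 1 ≤ |x| → W (x, y) = 0) : ∫ p, D p = 0 := by
  have hne : ∀ᵐ y : ℝ, y ≠ 0 := by simp [ae_iff]
  rw [Measure.volume_eq_prod] at hD ⊢
  rw [integral_prod_symm D hD]
  refine integral_eq_zero_of_ae ?_
  filter_upwards [hne, hD.prod_left_ae] with y hy hDy
  have hbot : Filter.Tendsto (fun x => W (x, y)) Filter.atBot (nhds 0) := by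
    refine tendsto_const_nhds.congr' ?_
    filter_upwards [Filter.eventually_le_atBot (-1)] with x hx
    exact (hW x y (by rw [abs_of_nonpos] <;> linarith)).symm
  have htop : Filter.Tendsto (fun x => W (x, y)) Filter.atTop (nhds 0) := by
    refine tendsto_const_nhds.congr' ?_
    filter_upwards [Filter.eventually_ge_atTop 1] with x hx
    exact (hW x y (by rw [abs_of_nonneg] <;> linarith)).symm
  simpa using integral_of_hasDerivAt_of_tendsto (hderiv y hy) hDy hbot htop

theorem integral_eq_zero_of_hasDerivAt_snd {W D : ℝ × ℝ → ℂ} (hD : Integrable D)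
    (hderiv : ∀ x ≠ 0, ∀ y, HasDerivAt (fun y => W (x, y)) (D (x, y)) y)
    (hW : ∀ x y : ℝ, 1 ≤ |y| → W (x, y) = 0) : ∫ p, D p = 0 := by
  have h := integral_eq_zero_of_hasDerivAt_fst (W := W ∘ Prod.swap) (D := D ∘ Prod.swap)
    hD.swap hderiv fun x y => hW y x
  rw [← h, Measure.volume_eq_prod]
  exact (integral_prod_swap D).symm

/-- The plane wave with frequency `-(a, b)`. -/
def planeWave (a b : ℝ) (p : ℝ × ℝ) : ℂ := Complex.exp (-(Complex.I * (a * p.1 + b * p.2)))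

theorem norm_planeWave (a b : ℝ) (p : ℝ × ℝ) : ‖planeWave a b p‖ = 1 := by
  rw [planeWave, Complex.norm_exp]
  simp

theorem measurable_planeWave (a b : ℝ) : Measurable (planeWave a b) := by
  unfold planeWave
  fun_prop

theorem hasDerivAt_planeWave_fst (a b x y : ℝ) :
    HasDerivAt (fun x => planeWave a b (x, y)) (-(Complex.I * a) * planeWave a b (x, y)) x := by
  have h : HasDerivAt (fun x : ℝ => -(Complex.I * ((a : ℂ) * (x : ℂ) + b * y)))
      (-(Complex.I * ((a : ℂ) * (1 : ℝ)))) x :=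
    ((((hasDerivAt_id x).ofReal_comp.const_mul (a : ℂ)).add_const _).const_mul _).neg
  refine h.cexp.congr_deriv ?_
  simp only [planeWave, Complex.ofReal_one]
  ring

theorem hasDerivAt_planeWave_snd (a b x y : ℝ) :
    HasDerivAt (fun y => planeWave a b (x, y)) (-(Complex.I * b) * planeWave a b (x, y)) y := by
  have h : HasDerivAt (fun y : ℝ => -(Complex.I * ((a : ℂ) * (x : ℂ) + b * y)))
      (-(Complex.I * ((b : ℂ) * (1 : ℝ)))) y :=
    ((((hasDerivAt_id y).ofReal_comp.const_mul (b : ℂ)).const_add _).const_mul _).neg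
  refine h.cexp.congr_deriv ?_
  simp only [planeWave, Complex.ofReal_one]
  ring

/-- Integrability of a radial profile times a monomial weight times a plane wave. -/
theorem integrable_weight_mul_radial_mul_planeWave {h : ℝ → ℝ} (hm : Measurable h)
    (h0 : ∀ s, 1 ≤ s → h s = 0) {q : ℝ × ℝ → ℝ} (hq : Measurable q) (C a b : ℝ)
    (hb : ∀ x y : ℝ, 0 < x ^ 2 + y ^ 2 → x ^ 2 + y ^ 2 < 1 →
      |q (x, y)| * |h (x ^ 2 + y ^ 2)| * √(x ^ 2 + y ^ 2) ≤ C) :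
    Integrable fun p : ℝ × ℝ =>
      ((q p * h (p.1 ^ 2 + p.2 ^ 2) : ℝ) : ℂ) * planeWave a b p := by
  have he := measurable_planeWave a b
  refine integrable_of_norm_mul_sqrt_le (Measurable.aestronglyMeasurable (by fun_prop)) C ?_ ?_
  · intro x y hs hs'
    rw [norm_mul, norm_planeWave, mul_one, Complex.norm_real, Real.norm_eq_abs, abs_mul]
    exact hb x y hs hs'
  · intro x y hs
    simp [h0 _ hs]

/-- Second Green identity against a plane wave for `x₁ H(|x|²)`, where the radial profile `H` may
have a mild singularity at the origin. -/
theorem integral_fst_mul_radial_mul_planeWave {H H₁ H₂ : ℝ → ℝ} (hm : Measurable H)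
    (hm₁ : Measurable H₁) (hm₂ : Measurable H₂)
    (hH : ∀ s, 0 < s → HasDerivAt H (H₁ s) s) (hH₁ : ∀ s, 0 < s → HasDerivAt H₁ (H₂ s) s)
    (h0 : ∀ s, 1 ≤ s → H s = 0) (h0₁ : ∀ s, 1 ≤ s → H₁ s = 0) (h0₂ : ∀ s, 1 ≤ s → H₂ s = 0)
    {C : ℝ} (hb : ∀ s, 0 < s → s < 1 → √s * |H s| ≤ C)
    (hb₁ : ∀ s, 0 < s → s < 1 → s * |H₁ s| ≤ C)
    (hb₂ : ∀ s, 0 < s → s < 1 → s ^ 2 * |H₂ s| ≤ C) (a b : ℝ) :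
    ((a ^ 2 + b ^ 2 : ℝ) : ℂ) *
        ∫ p : ℝ × ℝ, ((p.1 * H (p.1 ^ 2 + p.2 ^ 2) : ℝ) : ℂ) * planeWave a b p =
      -2 * Complex.I * a * (∫ p : ℝ × ℝ, ((H (p.1 ^ 2 + p.2 ^ 2) : ℝ) : ℂ) * planeWave a b p) -
        ∫ p : ℝ × ℝ, ((p.1 * (4 * H₁ (p.1 ^ 2 + p.2 ^ 2) +
          4 * (p.1 ^ 2 + p.2 ^ 2) * H₂ (p.1 ^ 2 + p.2 ^ 2)) : ℝ) : ℂ) * planeWave a b p := by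
  have abs_fst_le (x y : ℝ) : |x| ≤ √(x ^ 2 + y ^ 2) :=
    Real.abs_le_sqrt (by nlinarith [sq_nonneg y])
  have abs_snd_le (x y : ℝ) : |y| ≤ √(x ^ 2 + y ^ 2) :=
    Real.abs_le_sqrt (by nlinarith [sq_nonneg x])
  have iA : Integrable fun p : ℝ × ℝ =>
      ((H (p.1 ^ 2 + p.2 ^ 2) : ℝ) : ℂ) * planeWave a b p := by
    have := integrable_weight_mul_radial_mul_planeWave hm h0 (q := fun _ => 1) (by fun_prop) C a b
      (fun x y hs hs' => by
        have := hb _ hs hs'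
        rw [abs_one, one_mul, mul_comm]
        exact this)
    simpa using this
  have iB := integrable_weight_mul_radial_mul_planeWave hm h0 (q := fun p => p.1) (by fun_prop)
    C a b (fun x y hs hs' => by
      have h := hb _ hs hs'
      have hx : |x| ≤ 1 := (abs_fst_le x y).trans (Real.sqrt_le_one.2 hs'.le)
      calc |x| * |H (x ^ 2 + y ^ 2)| * √(x ^ 2 + y ^ 2)
          ≤ 1 * |H (x ^ 2 + y ^ 2)| * √(x ^ 2 + y ^ 2) := by gcongr
        _ ≤ C := by rw [one_mul, mul_comm]; exact h)
  have iC := integrable_weight_mul_radial_mul_planeWave hm₁ h0₁ (q := fun p => p.1) (by fun_prop)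
    C a b (fun x y hs hs' => by
      have h := hb₁ _ hs hs'
      calc |x| * |H₁ (x ^ 2 + y ^ 2)| * √(x ^ 2 + y ^ 2)
          ≤ √(x ^ 2 + y ^ 2) * |H₁ (x ^ 2 + y ^ 2)| * √(x ^ 2 + y ^ 2) := by
            gcongr; exact abs_fst_le x y
        _ = √(x ^ 2 + y ^ 2) ^ 2 * |H₁ (x ^ 2 + y ^ 2)| := by ring
        _ ≤ C := by rw [Real.sq_sqrt hs.le]; exact h)
  have iD := integrable_weight_mul_radial_mul_planeWave hm₂ h0₂ (q := fun p => p.1 ^ 3)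
    (by fun_prop) C a b (fun x y hs hs' => by
      have h := hb₂ _ hs hs'
      calc |x ^ 3| * |H₂ (x ^ 2 + y ^ 2)| * √(x ^ 2 + y ^ 2)
          = |x| ^ 3 * |H₂ (x ^ 2 + y ^ 2)| * √(x ^ 2 + y ^ 2) := by rw [abs_pow]
        _ ≤ √(x ^ 2 + y ^ 2) ^ 3 * |H₂ (x ^ 2 + y ^ 2)| * √(x ^ 2 + y ^ 2) := by
            gcongr; exact abs_fst_le x y
        _ = (√(x ^ 2 + y ^ 2) ^ 2) ^ 2 * |H₂ (x ^ 2 + y ^ 2)| := by ring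
        _ ≤ C := by rw [Real.sq_sqrt hs.le]; exact h)
  have iE := integrable_weight_mul_radial_mul_planeWave hm₂ h0₂ (q := fun p => p.1 * p.2 ^ 2)
    (by fun_prop) C a b (fun x y hs hs' => by
      have h := hb₂ _ hs hs'
      calc |x * y ^ 2| * |H₂ (x ^ 2 + y ^ 2)| * √(x ^ 2 + y ^ 2)
          = |x| * |y| ^ 2 * |H₂ (x ^ 2 + y ^ 2)| * √(x ^ 2 + y ^ 2) := by rw [abs_mul, abs_pow]
        _ ≤ √(x ^ 2 + y ^ 2) * √(x ^ 2 + y ^ 2) ^ 2 * |H₂ (x ^ 2 + y ^ 2)| *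
              √(x ^ 2 + y ^ 2) := by
            gcongr
            · exact abs_fst_le x y
            · exact abs_snd_le x y
        _ = (√(x ^ 2 + y ^ 2) ^ 2) ^ 2 * |H₂ (x ^ 2 + y ^ 2)| := by ring
        _ ≤ C := by rw [Real.sq_sqrt hs.le]; exact h)
  have one_le_fst (x y : ℝ) (hx : 1 ≤ |x|) : 1 ≤ x ^ 2 + y ^ 2 := by
    nlinarith [sq_abs x, sq_nonneg y]
  have one_le_snd (x y : ℝ) (hy : 1 ≤ |y|) : 1 ≤ x ^ 2 + y ^ 2 := by
    nlinarith [sq_abs y, sq_nonneg x]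
  have z₁ := integral_eq_zero_of_hasDerivAt_fst
    (W := fun p => (((2 * p.1 ^ 2 * H₁ (p.1 ^ 2 + p.2 ^ 2) - H (p.1 ^ 2 + p.2 ^ 2) : ℝ) : ℂ) +
      Complex.I * a * ((p.1 * H (p.1 ^ 2 + p.2 ^ 2) : ℝ) : ℂ)) * planeWave a b p)
    ((((iC.const_mul 2).add (iD.const_mul 4)).add (iA.const_mul (2 * Complex.I * a))).add
      (iB.const_mul ((a : ℂ) ^ 2)))
    (fun y hy x => by
      have hs : 0 < x ^ 2 + y ^ 2 := by positivity
      have hsd : HasDerivAt (fun x : ℝ => x ^ 2 + y ^ 2) (2 * x) x := by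
        simpa using (hasDerivAt_pow 2 x).add_const (y ^ 2)
      have hd := (hH _ hs).comp x hsd
      have hd₁ := (hH₁ _ hs).comp x hsd
      have hx2 : HasDerivAt (fun x : ℝ => 2 * x ^ 2) (2 * (2 * x)) x := by
        simpa using (hasDerivAt_pow 2 x).const_mul 2
      have t₁ := ((hx2.mul hd₁).sub hd).ofReal_comp
      have t₂ := (((hasDerivAt_id x).mul hd).ofReal_comp).const_mul (Complex.I * (a : ℂ))
      refine ((t₁.add t₂).mul (hasDerivAt_planeWave_fst a b x y)).congr_deriv ?_
      simp only [Pi.add_apply, Pi.sub_apply, Pi.mul_apply, Function.comp_apply, id]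
      push_cast
      linear_combination (-(a : ℂ) ^ 2 * x * H (x ^ 2 + y ^ 2) * planeWave a b (x, y)) *
        Complex.I_sq)
    (fun x y hx => by
      simp only [h0 _ (one_le_fst x y hx), h0₁ _ (one_le_fst x y hx)]
      simp)
  have z₂ := integral_eq_zero_of_hasDerivAt_snd
    (W := fun p => (((2 * p.1 * p.2 * H₁ (p.1 ^ 2 + p.2 ^ 2) : ℝ) : ℂ) +
      Complex.I * b * ((p.1 * H (p.1 ^ 2 + p.2 ^ 2) : ℝ) : ℂ)) * planeWave a b p)
    (((iC.const_mul 2).add (iE.const_mul 4)).add (iB.const_mul ((b : ℂ) ^ 2)))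
    (fun x hx y => by
      have hs : 0 < x ^ 2 + y ^ 2 := by positivity
      have hsd : HasDerivAt (fun y : ℝ => x ^ 2 + y ^ 2) (2 * y) y := by
        simpa using (hasDerivAt_pow 2 y).const_add (x ^ 2)
      have hd := (hH _ hs).comp y hsd
      have hd₁ := (hH₁ _ hs).comp y hsd
      have t₁ := (((hasDerivAt_id y).const_mul (2 * x)).mul hd₁).ofReal_comp
      have t₂ := ((hd.const_mul x).ofReal_comp).const_mul (Complex.I * (b : ℂ))
      refine ((t₁.add t₂).mul (hasDerivAt_planeWave_snd a b x y)).congr_deriv ?_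
      simp only [Pi.add_apply, Pi.mul_apply, Function.comp_apply, id]
      push_cast
      linear_combination (-(b : ℂ) ^ 2 * x * H (x ^ 2 + y ^ 2) * planeWave a b (x, y)) *
        Complex.I_sq)
    (fun x y hy => by
      simp only [h0 _ (one_le_snd x y hy), h0₁ _ (one_le_snd x y hy)]
      simp)
  rw [integral_add' (((iC.const_mul 2).add (iD.const_mul 4)).add
      (iA.const_mul (2 * Complex.I * a))) (iB.const_mul ((a : ℂ) ^ 2)),
    integral_add' ((iC.const_mul 2).add (iD.const_mul 4)) (iA.const_mul (2 * Complex.I * a)),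
    integral_add' (iC.const_mul 2) (iD.const_mul 4)] at z₁
  rw [integral_add' ((iC.const_mul 2).add (iE.const_mul 4)) (iB.const_mul ((b : ℂ) ^ 2)),
    integral_add' (iC.const_mul 2) (iE.const_mul 4)] at z₂
  simp only [integral_const_mul] at z₁ z₂
  have hΦ : ∫ p : ℝ × ℝ, ((p.1 * (4 * H₁ (p.1 ^ 2 + p.2 ^ 2) +
      4 * (p.1 ^ 2 + p.2 ^ 2) * H₂ (p.1 ^ 2 + p.2 ^ 2)) : ℝ) : ℂ) * planeWave a b p =
      4 * (∫ p : ℝ × ℝ, ((p.1 * H₁ (p.1 ^ 2 + p.2 ^ 2) : ℝ) : ℂ) * planeWave a b p) +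
      4 * (∫ p : ℝ × ℝ, ((p.1 ^ 3 * H₂ (p.1 ^ 2 + p.2 ^ 2) : ℝ) : ℂ) * planeWave a b p) +
      4 * ∫ p : ℝ × ℝ, ((p.1 * p.2 ^ 2 * H₂ (p.1 ^ 2 + p.2 ^ 2) : ℝ) : ℂ) *
        planeWave a b p := by
    simp only [← integral_const_mul]
    rw [← integral_add' (iC.const_mul 4) (iD.const_mul 4),
      ← integral_add' ((iC.const_mul 4).add (iD.const_mul 4)) (iE.const_mul 4)]
    congr 1
    ext p
    push_cast [Pi.add_apply]
    ring
  rw [hΦ, Complex.ofReal_add, Complex.ofReal_pow, Complex.ofReal_pow]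
  linear_combination z₁ + z₂

theorem EuclideanSpace.integral_comp_fin_two (F : ℝ × ℝ → ℂ) :
    ∫ x : EuclideanSpace ℝ (Fin 2), F (x 0, x 1) = ∫ p, F p := by
  rw [← (volume_preserving_finTwoArrow ℝ).integral_comp' F,
    ← (EuclideanSpace.volume_preserving_symm_measurableEquiv_toLp (Fin 2)).integral_comp']
  rfl

/-- The Fourier coefficient of a function supported in the fundamental rectangle is an integral
over the whole plane. -/
theorem fourierCoef_eq_integral_planeWave {ct : ℝ} {g : EuclideanSpace ℝ (Fin 2) → ℝ}
    {F : ℝ × ℝ → ℝ} {k : ℝ} (hg0 : ∀ x ∉ domD ct, g x = 0) (hg : ∀ x, g x = k * F (x 0, x 1))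
    (j : ℤ × ℤ) :
    fourierCoef ct (fun x => (g x : ℂ)) j = ((1 / (2 * √(π * ct)) : ℝ) : ℂ) * k *
      ∫ p, (F p : ℂ) * planeWave j.1 (j.2 * π / ct) p := by
  rw [fourierCoef, setIntegral_eq_integral_of_forall_compl_eq_zero fun x hx => by simp [hg0 x hx],
    ← integral_const_mul, ← EuclideanSpace.integral_comp_fin_two]
  congr 1
  ext x
  rw [hg x, fBasis, planeWave]
  have hexp : Complex.I * ((((-j).1 : ℤ) : ℂ) * (x 0 : ℂ) +
      (((-j).2 : ℤ) : ℂ) * (π : ℂ) * (x 1 : ℂ) / (ct : ℂ)) =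
      -(Complex.I * (((j.1 : ℝ) : ℂ) * (x 0 : ℂ) + ((j.2 * π / ct : ℝ) : ℂ) * (x 1 : ℂ))) := by
    push_cast [Prod.fst_neg, Prod.snd_neg]
    ring
  rw [hexp]
  push_cast
  ring

theorem lt_norm_of_notMem_domD {ct δ : ℝ} (hδ : δ ≤ 1) (hδ' : δ ≤ ct)
    {x : EuclideanSpace ℝ (Fin 2)} (hx : x ∉ domD ct) : δ < ‖x‖ := by
  by_contra! h
  have hi (i : Fin 2) : |x i| ≤ δ := (Real.norm_eq_abs _ ▸ PiLp.norm_apply_le x i).trans h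
  have hπ := Real.pi_gt_three
  exact hx ⟨abs_le.1 ((hi 0).trans (by linarith)), abs_le.1 ((hi 1).trans hδ')⟩

/-- The profile `s ↦ ln √s · 𝒴(√s)`, so that `ln |x| · 𝒴(|x|)` is its value at `|x|²`. -/
def logProfile (𝒴 : ℝ → ℝ) (s : ℝ) : ℝ := Real.log √s * 𝒴 √s

/-- The first derivative of `logProfile`. -/
def logProfileDeriv (𝒴 : ℝ → ℝ) (s : ℝ) : ℝ :=
  (𝒴 √s / √s + Real.log √s * deriv 𝒴 √s) / (2 * √s)

/-- The second derivative of `logProfile`. -/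
def logProfileDeriv₂ (𝒴 : ℝ → ℝ) (s : ℝ) : ℝ :=
  (2 * deriv 𝒴 √s / √s - 2 * 𝒴 √s / √s ^ 2 + Real.log √s * deriv (deriv 𝒴) √s -
    Real.log √s * deriv 𝒴 √s / √s) / (4 * √s ^ 2)

theorem hasDerivAt_logProfile {𝒴 : ℝ → ℝ} (h𝒴 : Differentiable ℝ 𝒴) {s : ℝ} (hs : 0 < s) :
    HasDerivAt (logProfile 𝒴) (logProfileDeriv 𝒴 s) s := by
  have hr : 0 < √s := Real.sqrt_pos.2 hs
  have h := ((Real.hasDerivAt_log hr.ne').mul (h𝒴 √s).hasDerivAt).comp s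
    (Real.hasDerivAt_sqrt hs.ne')
  refine h.congr_deriv ?_
  simp only [logProfileDeriv]
  field_simp

theorem hasDerivAt_logProfileDeriv {𝒴 : ℝ → ℝ} (h𝒴 : Differentiable ℝ 𝒴)
    (h𝒴' : Differentiable ℝ (deriv 𝒴)) {s : ℝ} (hs : 0 < s) :
    HasDerivAt (logProfileDeriv 𝒴) (logProfileDeriv₂ 𝒴 s) s := by
  have hr : 0 < √s := Real.sqrt_pos.2 hs
  have h := ((((h𝒴 √s).hasDerivAt.div (hasDerivAt_id √s) hr.ne').add
    ((Real.hasDerivAt_log hr.ne').mul (h𝒴' √s).hasDerivAt)).div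
    ((hasDerivAt_id √s).const_mul 2) (mul_pos two_pos hr).ne').comp s
    (Real.hasDerivAt_sqrt hs.ne')
  refine h.congr_deriv ?_
  simp only [logProfileDeriv₂, Pi.add_apply, Pi.mul_apply, Pi.div_apply, id]
  field_simp
  ring

theorem abs_sqrt_mul_log_sqrt_le {s : ℝ} (hs : 0 < s) (hs' : s < 1) : |√s * Real.log √s| ≤ 1 := by
  rw [mul_comm]
  exact (Real.abs_log_mul_self_lt _ (Real.sqrt_pos.2 hs) (Real.sqrt_le_one.2 hs'.le)).le

theorem sqrt_mul_abs_logProfile_le {𝒴 : ℝ → ℝ} {s M : ℝ} (hs : 0 < s) (hs' : s < 1)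
    (hM : |𝒴 √s| ≤ M) : √s * |logProfile 𝒴 s| ≤ M := by
  have hl := abs_sqrt_mul_log_sqrt_le hs hs'
  calc √s * |logProfile 𝒴 s| = |√s * Real.log √s| * |𝒴 √s| := by
        rw [logProfile, abs_mul, abs_mul, abs_of_nonneg (Real.sqrt_nonneg s)]
        ring
    _ ≤ 1 * M := by gcongr
    _ = M := one_mul M

theorem mul_abs_logProfileDeriv_le {𝒴 : ℝ → ℝ} {s M : ℝ} (hs : 0 < s) (hs' : s < 1)
    (hM : |𝒴 √s| ≤ M) (hM' : |deriv 𝒴 √s| ≤ M) : s * |logProfileDeriv 𝒴 s| ≤ M := by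
  have hr : 0 < √s := Real.sqrt_pos.2 hs
  have hl := abs_sqrt_mul_log_sqrt_le hs hs'
  have h : |√s * Real.log √s * deriv 𝒴 √s| ≤ 1 * M := by
    rw [abs_mul]
    gcongr
  calc s * |logProfileDeriv 𝒴 s| = |√s ^ 2 * logProfileDeriv 𝒴 s| := by
        rw [Real.sq_sqrt hs.le, abs_mul, abs_of_pos hs]
    _ = |(𝒴 √s + √s * Real.log √s * deriv 𝒴 √s) / 2| := by
        rw [logProfileDeriv]
        congr 1
        field_simp
    _ ≤ M := by
        rw [abs_le] at *
        constructor <;> linarith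

theorem sq_mul_abs_logProfileDeriv₂_le {𝒴 : ℝ → ℝ} {s M : ℝ} (hs : 0 < s) (hs' : s < 1)
    (hM : |𝒴 √s| ≤ M) (hM' : |deriv 𝒴 √s| ≤ M) (hM'' : |deriv (deriv 𝒴) √s| ≤ M) :
    s ^ 2 * |logProfileDeriv₂ 𝒴 s| ≤ 2 * M := by
  have hr : 0 < √s := Real.sqrt_pos.2 hs
  have hr' : |√s| ≤ 1 := by rw [abs_of_pos hr]; exact Real.sqrt_le_one.2 hs'.le
  have hl := abs_sqrt_mul_log_sqrt_le hs hs'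
  have hM0 : 0 ≤ M := (abs_nonneg _).trans hM
  have h₁ : |√s * Real.log √s * deriv 𝒴 √s| ≤ 1 * M := by
    rw [abs_mul]
    gcongr
  have h₂ : |√s * (√s * Real.log √s * deriv (deriv 𝒴) √s)| ≤ 1 * (1 * M) := by
    rw [abs_mul, abs_mul (√s * Real.log √s)]
    gcongr
  have h₃ : |√s * deriv 𝒴 √s| ≤ 1 * M := by
    rw [abs_mul]
    gcongr
  calc s ^ 2 * |logProfileDeriv₂ 𝒴 s| = |(√s ^ 2) ^ 2 * logProfileDeriv₂ 𝒴 s| := by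
        rw [Real.sq_sqrt hs.le, abs_mul, abs_of_pos (pow_pos hs 2)]
    _ = |(2 * (√s * deriv 𝒴 √s) - 2 * 𝒴 √s + √s * (√s * Real.log √s * deriv (deriv 𝒴) √s) -
          √s * Real.log √s * deriv 𝒴 √s) / 4| := by
        rw [logProfileDeriv₂]
        congr 1
        field_simp
    _ ≤ 2 * M := by
        rw [abs_le] at *
        constructor <;> linarith

theorem norm_eq_sqrt_fin_two (x : EuclideanSpace ℝ (Fin 2)) : ‖x‖ = √(x 0 ^ 2 + x 1 ^ 2) := by
  simp [EuclideanSpace.norm_eq, Fin.sum_univ_two]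

theorem funPhi2_eq_logProfile (𝒴 : ℝ → ℝ) (x : EuclideanSpace ℝ (Fin 2)) :
    funPhi2 𝒴 x = x 0 * (4 * logProfileDeriv 𝒴 (x 0 ^ 2 + x 1 ^ 2) +
      4 * (x 0 ^ 2 + x 1 ^ 2) * logProfileDeriv₂ 𝒴 (x 0 ^ 2 + x 1 ^ 2)) := by
  rcases (add_nonneg (sq_nonneg (x 0)) (sq_nonneg (x 1))).eq_or_lt with h | h
  · have : x 0 = 0 := by nlinarith [sq_nonneg (x 0), sq_nonneg (x 1)]
    simp [funPhi2, this]
  · have hr := Real.sqrt_pos.2 h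
    have hsq := Real.sq_sqrt h.le
    rw [funPhi2, funPhi1, norm_eq_sqrt_fin_two, logProfileDeriv, logProfileDeriv₂]
    set r := √(x 0 ^ 2 + x 1 ^ 2)
    rw [← hsq]
    field_simp
    ring

/-- For j ≠ (0,0): (j₁² + j₂²π²/c̃²) F̂_{2,j} = −2ij₁ F̂_{1,j} + (1/(2π)) Φ̂_{2,j}. -/
theorem statement5 (c ct ε : ℝ) (hc : 0 < c) (hcct : c < ct)
    (hε : 0 < ε) (hε' : ε < min 1 ct / 2)
    (𝒴 : ℝ → ℝ) (h𝒴 : ContDiff ℝ (⊤ : ℕ∞) 𝒴)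
    (h𝒴1 : ∀ t : ℝ, t ≤ ε → 𝒴 t = 1)
    (h𝒴0 : ∀ t : ℝ, 2 * ε ≤ t → 𝒴 t = 0)
    (j : ℤ × ℤ) (hj : j ≠ (0, 0)) :
    (((j.1 : ℝ) ^ 2 + (j.2 : ℝ) ^ 2 * π ^ 2 / ct ^ 2 : ℝ) : ℂ) *
        fourierCoef ct (fun x => ((funF2 𝒴 x : ℝ) : ℂ)) j =
      -2 * Complex.I * (j.1 : ℂ) * fourierCoef ct (fun x => ((funF1 𝒴 x : ℝ) : ℂ)) j +
        ((1 / (2 * π) : ℝ) : ℂ) * fourierCoef ct (fun x => ((funPhi2 𝒴 x : ℝ) : ℂ)) j := by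
  have hε1 : 2 * ε < 1 := by linarith [min_le_left 1 ct]
  have hεct : 2 * ε < ct := by linarith [min_le_right 1 ct]
  have hY : Differentiable ℝ 𝒴 := h𝒴.differentiable (by simp)
  have hY1 : ContDiff ℝ (⊤ : ℕ∞) (deriv 𝒴) := ((contDiff_infty_iff_deriv).1 h𝒴).2
  have hY' : Differentiable ℝ (deriv 𝒴) := hY1.differentiable (by simp)
  have hY2 : Continuous (deriv (deriv 𝒴)) := hY1.continuous_deriv (by simp)
  have hY0 : ∀ t, 2 * ε < t → 𝒴 t = 0 := fun t ht => h𝒴0 t ht.le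
  have deriv_eq_zero {f : ℝ → ℝ} (hf : ∀ t, 2 * ε < t → f t = 0) (t : ℝ) (ht : 2 * ε < t) :
      deriv f t = 0 := by
    have h : f =ᶠ[nhds t] fun _ => 0 := by
      filter_upwards [lt_mem_nhds ht] with u hu using hf u hu
    simp [h.deriv_eq]
  have hY0' := deriv_eq_zero hY0
  have hY0'' := deriv_eq_zero hY0'
  obtain ⟨M₀, hM₀⟩ := isCompact_Icc.exists_bound_of_continuousOn
    (hY.continuous.continuousOn (s := Set.Icc 0 1))
  obtain ⟨M₁, hM₁⟩ := isCompact_Icc.exists_bound_of_continuousOn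
    (hY'.continuous.continuousOn (s := Set.Icc 0 1))
  obtain ⟨M₂, hM₂⟩ := isCompact_Icc.exists_bound_of_continuousOn
    (hY2.continuousOn (s := Set.Icc 0 1))
  simp only [Real.norm_eq_abs] at hM₀ hM₁ hM₂
  set M := max M₀ (max M₁ M₂)
  have hM0 : 0 ≤ M := (abs_nonneg _).trans ((hM₀ 0 (by simp)).trans (le_max_left _ _))
  have sqrt_mem {s : ℝ} (hs : s < 1) : √s ∈ Set.Icc (0 : ℝ) 1 :=
    ⟨Real.sqrt_nonneg s, Real.sqrt_le_one.2 hs.le⟩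
  have b₀ {s : ℝ} (hs : s < 1) : |𝒴 √s| ≤ M := (hM₀ _ (sqrt_mem hs)).trans (le_max_left _ _)
  have b₁ {s : ℝ} (hs : s < 1) : |deriv 𝒴 √s| ≤ M :=
    (hM₁ _ (sqrt_mem hs)).trans ((le_max_left _ _).trans (le_max_right _ _))
  have b₂ {s : ℝ} (hs : s < 1) : |deriv (deriv 𝒴) √s| ≤ M :=
    (hM₂ _ (sqrt_mem hs)).trans ((le_max_right _ _).trans (le_max_right _ _))
  have lt_sqrt {s : ℝ} (hs : 1 ≤ s) : 2 * ε < √s := hε1.trans_le (Real.one_le_sqrt.2 hs)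
  have m₀ : Measurable 𝒴 := hY.continuous.measurable
  have m₁ : Measurable (deriv 𝒴) := measurable_deriv 𝒴
  have m₂ : Measurable (deriv (deriv 𝒴)) := measurable_deriv _
  have key := integral_fst_mul_radial_mul_planeWave (H := logProfile 𝒴)
    (H₁ := logProfileDeriv 𝒴) (H₂ := logProfileDeriv₂ 𝒴) (C := 2 * M)
    (by unfold logProfile; fun_prop) (by unfold logProfileDeriv; fun_prop)
    (by unfold logProfileDeriv₂; fun_prop)
    (fun s hs => hasDerivAt_logProfile hY hs) (fun s hs => hasDerivAt_logProfileDeriv hY hY' hs)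
    (fun s hs => by simp [logProfile, hY0 _ (lt_sqrt hs)])
    (fun s hs => by simp [logProfileDeriv, hY0 _ (lt_sqrt hs), hY0' _ (lt_sqrt hs)])
    (fun s hs => by
      simp [logProfileDeriv₂, hY0 _ (lt_sqrt hs), hY0' _ (lt_sqrt hs), hY0'' _ (lt_sqrt hs)])
    (fun s hs hs' => (sqrt_mul_abs_logProfile_le hs hs' (b₀ hs')).trans (by linarith))
    (fun s hs hs' => (mul_abs_logProfileDeriv_le hs hs' (b₀ hs') (b₁ hs')).trans (by linarith))
    (fun s hs hs' => sq_mul_abs_logProfileDeriv₂_le hs hs' (b₀ hs') (b₁ hs') (b₂ hs'))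
    j.1 (j.2 * π / ct)
  have hout (x : EuclideanSpace ℝ (Fin 2)) (hx : x ∉ domD ct) : 2 * ε < ‖x‖ :=
    lt_norm_of_notMem_domD hε1.le hεct.le hx
  rw [fourierCoef_eq_integral_planeWave (g := funF2 𝒴) (k := -(1 / (2 * π)))
      (F := fun p => p.1 * logProfile 𝒴 (p.1 ^ 2 + p.2 ^ 2))
      (fun x hx => by simp [funF2, hY0 _ (hout x hx)])
      (fun x => by simp only [funF2, logProfile, norm_eq_sqrt_fin_two]; ring),
    fourierCoef_eq_integral_planeWave (g := funF1 𝒴) (k := -(1 / (2 * π)))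
      (F := fun p => logProfile 𝒴 (p.1 ^ 2 + p.2 ^ 2))
      (fun x hx => by simp [funF1, hY0 _ (hout x hx)])
      (fun x => by simp only [funF1, logProfile, norm_eq_sqrt_fin_two]; ring),
    fourierCoef_eq_integral_planeWave (g := funPhi2 𝒴) (k := 1)
      (F := fun p => p.1 * (4 * logProfileDeriv 𝒴 (p.1 ^ 2 + p.2 ^ 2) +
        4 * (p.1 ^ 2 + p.2 ^ 2) * logProfileDeriv₂ 𝒴 (p.1 ^ 2 + p.2 ^ 2)))
      (fun x hx => by simp [funPhi2, funPhi1, hY0' _ (hout x hx), hY0'' _ (hout x hx)])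
      (fun x => by rw [one_mul, funPhi2_eq_logProfile]),
    show (j.1 : ℝ) ^ 2 + (j.2 : ℝ) ^ 2 * π ^ 2 / ct ^ 2 = (j.1 : ℝ) ^ 2 + (j.2 * π / ct) ^ 2 by
      ring]
  simp only [Complex.ofReal_intCast] at key
  rw [Complex.ofReal_neg, Complex.ofReal_one]
  linear_combination (-(((1 / (2 * √(π * ct)) : ℝ) : ℂ) * ((1 / (2 * π) : ℝ) : ℂ))) * key

end
end

section
/- Let m ∈ ℕ and suppose 𝒳 ∈ C^{m+3}(ℝ) is a cut-off with 𝒳(t) = 1 for |t| ≤ c and 𝒳(t) = 0 for |t| ≥ (c+c̃)/2, where 0 < c < c̃. Then for every β = is with s > 0 (purely imaginary with positive imaginary part) and every real a, | ∫₀^{c̃} e^{i(β − a)t} 𝒳′(t) dt | ≤ e^{−sc} · ‖𝒳^{(m+3)}‖_{L¹[0,c̃]} / |β − a|^{m+2}. -/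
open MeasureTheory Complex Real

noncomputable section

/-- All derivatives of positive order vanish where a function is locally constant. -/
lemma iteratedDeriv_eq_zero_of_eventuallyEq_const {f : ℝ → ℝ} {t b : ℝ}
    (h : f =ᶠ[nhds t] fun _ => b) {k : ℕ} (hk : k ≠ 0) : iteratedDeriv k f t = 0 := by
  rw [h.iteratedDeriv_eq k, iteratedDeriv_const]
  simp [hk]

/-- Integration by parts against an exponential, for a function vanishing at the endpoints. -/
lemma mul_integral_exp_mul_eq_neg {f f' : ℝ → ℝ} {a b : ℝ} (z : ℂ)
    (hf : ∀ t, HasDerivAt f (f' t) t) (hf' : Continuous f') (ha : f a = 0) (hb : f b = 0) :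
    z * (∫ t in a..b, Complex.exp (z * (t : ℂ)) * (f t : ℂ)) =
      -∫ t in a..b, Complex.exp (z * (t : ℂ)) * (f' t : ℂ) := by
  have hexp : ∀ t : ℝ, HasDerivAt (fun x : ℝ => Complex.exp (z * (x : ℂ)))
      (z * Complex.exp (z * (t : ℂ))) t := fun t => by
    have h := (((hasDerivAt_id (t : ℂ)).const_mul z).cexp).comp_ofReal
    simpa [mul_comm] using h
  have key := intervalIntegral.integral_mul_deriv_eq_deriv_mul (a := a) (b := b)
    (fun t _ => hexp t) (fun t _ => (hf t).ofReal_comp)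
    (Continuous.intervalIntegrable (by fun_prop) _ _)
    (Continuous.intervalIntegrable (by fun_prop) _ _)
  simp only [ha, hb] at key
  rw [key, ← intervalIntegral.integral_const_mul]
  simp [mul_assoc]

/-- Repeated integration by parts against an exponential, starting from the first derivative. -/
lemma norm_pow_mul_norm_integral_exp_mul_deriv {f : ℝ → ℝ} {a b : ℝ} (z : ℂ) (n : ℕ)
    (hf : ContDiff ℝ (n + 1 : ℕ) f)
    (ha : ∀ k, k ≠ 0 → iteratedDeriv k f a = 0) (hb : ∀ k, k ≠ 0 → iteratedDeriv k f b = 0) :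
    ‖z‖ ^ n * ‖∫ t in a..b, Complex.exp (z * (t : ℂ)) * ((deriv f t : ℝ) : ℂ)‖ =
      ‖∫ t in a..b, Complex.exp (z * (t : ℂ)) * ((iteratedDeriv (n + 1) f t : ℝ) : ℂ)‖ := by
  induction n with
  | zero => simp
  | succ n ih =>
    have hd : ∀ t, HasDerivAt (iteratedDeriv (n + 1) f) (iteratedDeriv (n + 1 + 1) f t) t := by
      intro t
      rw [iteratedDeriv_succ (n := n + 1)]
      exact (hf.differentiable_iteratedDeriv (n + 1)
        (by exact_mod_cast Nat.lt_succ_self (n + 1)) t).hasDerivAt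
    have h := mul_integral_exp_mul_eq_neg z hd (hf.continuous_iteratedDeriv _ le_rfl)
      (ha _ n.succ_ne_zero) (hb _ n.succ_ne_zero)
    rw [pow_succ', mul_assoc, ih (hf.of_le (by exact_mod_cast Nat.le_succ (n + 1))), ← norm_mul,
      h, norm_neg]

/-- If 𝒳 ∈ C^{m+3} is a cut-off (≡1 on [−c,c], ≡0 off (−(c+c̃)/2,(c+c̃)/2)), then for
β = is with s > 0 and a real,
|∫₀^{c̃} e^{i(β−a)t} 𝒳′(t) dt| ≤ e^{−sc} ‖𝒳^{(m+3)}‖_{L¹[0,c̃]} / |β−a|^{m+2}. -/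
theorem statement15 (m : ℕ) (c ct : ℝ) (hc : 0 < c) (hcct : c < ct)
    (𝒳 : ℝ → ℝ) (h𝒳 : ContDiff ℝ (m + 3) 𝒳)
    (h𝒳1 : ∀ t : ℝ, |t| ≤ c → 𝒳 t = 1)
    (h𝒳0 : ∀ t : ℝ, (c + ct) / 2 ≤ |t| → 𝒳 t = 0)
    (s : ℝ) (hs : 0 < s) (a : ℝ) :
    ‖∫ t in (0 : ℝ)..ct,
        Complex.exp (Complex.I * (Complex.I * (s : ℂ) - (a : ℂ)) * (t : ℂ)) *
          ((deriv 𝒳 t : ℝ) : ℂ)‖ ≤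
      Real.exp (-s * c) * (∫ t in (0 : ℝ)..ct, |iteratedDeriv (m + 3) 𝒳 t|) /
        ‖Complex.I * (s : ℂ) - (a : ℂ)‖ ^ (m + 2) := by
  set z : ℂ := Complex.I * (Complex.I * (s : ℂ) - (a : ℂ)) with hz
  have hzre : z.re = -s := by simp [hz]
  have hnorm : ‖z‖ = ‖Complex.I * (s : ℂ) - (a : ℂ)‖ := by simp [hz]
  have hzpos : 0 < ‖z‖ := by
    refine norm_pos_iff.mpr fun h => ?_
    rw [h, Complex.zero_re] at hzre
    linarith
  have hlow : ∀ k, k ≠ 0 → ∀ t, 0 ≤ t → t < c → iteratedDeriv k 𝒳 t = 0 := by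
    intro k hk t ht0 htc
    refine iteratedDeriv_eq_zero_of_eventuallyEq_const (b := 1) ?_ hk
    filter_upwards [continuous_abs.continuousAt.eventually_lt_const
      (show |t| < c by rwa [abs_of_nonneg ht0])] with x hx
    exact h𝒳1 x hx.le
  have hhigh : ∀ k, k ≠ 0 → iteratedDeriv k 𝒳 ct = 0 := by
    intro k hk
    refine iteratedDeriv_eq_zero_of_eventuallyEq_const (b := 0) ?_ hk
    filter_upwards [lt_mem_nhds (show (c + ct) / 2 < ct by linarith)] with x hx
    exact h𝒳0 x (hx.le.trans (le_abs_self x))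
  have hC : ContDiff ℝ (m + 2 + 1 : ℕ) 𝒳 := by exact_mod_cast h𝒳
  have hcont : Continuous (iteratedDeriv (m + 3) 𝒳) := hC.continuous_iteratedDeriv _ le_rfl
  have hparts := norm_pow_mul_norm_integral_exp_mul_deriv z (m + 2) hC
    (fun k hk => hlow k hk 0 le_rfl hc) hhigh
  rw [← hnorm, le_div_iff₀' (pow_pos hzpos _), hparts, ← intervalIntegral.integral_const_mul]
  refine intervalIntegral.norm_integral_le_of_norm_le (hc.trans hcct).le
    (Filter.Eventually.of_forall fun t ht => ?_)
    (Continuous.intervalIntegrable (by fun_prop) _ _)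
  rcases lt_or_ge t c with htc | htc
  · simp [hlow (m + 3) (by omega) t ht.1.le htc]
  · rw [norm_mul, Complex.norm_exp, Complex.re_mul_ofReal, hzre, Complex.norm_real,
      Real.norm_eq_abs]
    gcongr ?_ * _
    exact Real.exp_le_exp.mpr (by nlinarith)

end
end
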